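/- In the tree setting with nesting (i) and goodness (iii), for every node u at level k with 1 ≤ k ≤ 2ℓ−1 (so u is neither a leaf nor the root), one has |B_u| ≤ 250√n(log₂ n) · ∑_{a ∈ [N]} min(|P_{u∘a}|², |P_u|). -/

import Mathlib

open scoped Classical
open Finset

/-- Hamming weight. -/
def hwt {n : ℕ} (x : Fin n → Bool) : ℕ := (univ.filter fun i => x i = true).card

/-- `x` lies in the middle layers: `n/2 - √n ≤ |x| ≤ n/2 + √n` (with `s = √n`). -/
def MiddleLayers (n s : ℕ) (x : Fin n → Bool) : Prop :=
  n ≤ 2 * hwt x + 2 * s ∧ 2 * hwt x ≤ n + 2 * s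

/-- `A_{u,b}`: the coordinates on which all points of `S` equal `b`. -/
def Aset {n : ℕ} (S : Finset (Fin n → Bool)) (b : Bool) : Finset (Fin n) :=
  univ.filter fun i => ∀ x ∈ S, x i = b

/-- Nodes of the complete `N`-ary tree of depth `2ℓ` are encoded as lists over
`Fin N` of length at most `2ℓ` (the list of child indices from the node up to the
root, most recent first; the root is `[]` and the children of `u` are `a :: u`).
`Bset ℓ P u` is the union, over the leaves `w ++ u` of the subtree rooted at `u`,
of the dangerous sets `D_{w++u} = {i : ∃ x y ∈ P_{w++u}, x i ≠ y i}`. -/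
noncomputable def Bset (ℓ : ℕ) {n N : ℕ} (P : List (Fin N) → Finset (Fin n → Bool))
    (u : List (Fin N)) : Finset (Fin n) :=
  univ.filter fun i => ∃ w : List (Fin N), w.length + u.length = 2 * ℓ ∧
    ∃ x ∈ P (w ++ u), ∃ y ∈ P (w ++ u), x i ≠ y i

/-- The coordinates on which the points of `S` do not all agree. -/
noncomputable def dangerSet {n : ℕ} (S : Finset (Fin n → Bool)) : Finset (Fin n) :=
  univ.filter fun i => ∃ x ∈ S, ∃ y ∈ S, x i ≠ y i

lemma card_filter_eq_le_of_middleLayers {n s : ℕ} {x : Fin n → Bool} (hx : MiddleLayers n s x)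
    (b : Bool) : 2 * (univ.filter fun i => x i = b).card ≤ n + 2 * s := by
  cases b with
  | true => exact hx.2
  | false =>
    have h := Finset.card_filter_add_card_filter_not (s := (univ : Finset (Fin n)))
      (fun i => x i = true)
    simp only [Bool.not_eq_true, card_univ, Fintype.card_fin] at h
    have h1 := hx.1
    unfold hwt at h1
    omega

lemma Aset_anti {n : ℕ} {S T : Finset (Fin n → Bool)} (h : S ⊆ T) (b : Bool) :
    Aset T b ⊆ Aset S b := by
  intro i hi
  simp only [Aset, mem_filter, mem_univ, true_and] at hi ⊢
  exact fun x hx => hi x (h hx)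

lemma card_dangerSet_add_le {n : ℕ} {S T : Finset (Fin n → Bool)} (hST : S ⊆ T)
    (hS : S.Nonempty) (b : Bool) :
    (dangerSet S).card + (Aset S b).card + (Aset T (!b)).card ≤ n := by
  obtain ⟨z, hz⟩ := hS
  have h1 : Disjoint (dangerSet S) (Aset S b) := by
    rw [Finset.disjoint_left]
    intro i hi hA
    simp only [dangerSet, Aset, mem_filter, mem_univ, true_and] at hi hA
    obtain ⟨x, hx, y, hy, hxy⟩ := hi
    exact hxy ((hA x hx).trans (hA y hy).symm)
  have h2 : Disjoint (dangerSet S ∪ Aset S b) (Aset T (!b)) := by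
    rw [Finset.disjoint_left]
    intro i hi hA
    replace hA := Aset_anti hST _ hA
    simp only [dangerSet, Aset, mem_union, mem_filter, mem_univ, true_and] at hi hA
    rcases hi with ⟨x, hx, y, hy, hxy⟩ | hi
    · exact hxy ((hA x hx).trans (hA y hy).symm)
    · have h3 := (hi z hz).symm.trans (hA z hz)
      cases b <;> simp at h3
  rw [← card_union_of_disjoint h1, ← card_union_of_disjoint h2]
  simpa using card_le_univ (dangerSet S ∪ Aset S b ∪ Aset T (!b))

/-- Every dangerous coordinate is a `b`-coordinate, outside `Aset S b`, of some point of `S`. -/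
lemma card_dangerSet_le_sum {n : ℕ} (S : Finset (Fin n → Bool)) (b : Bool) :
    (dangerSet S).card ≤
      ∑ x ∈ S, ((univ.filter fun i => x i = b).card - (Aset S b).card) := by
  have hsub : dangerSet S ⊆ S.biUnion fun x => (univ.filter fun i => x i = b) \ Aset S b := by
    intro i hi
    simp only [dangerSet, Aset, mem_filter, mem_univ, true_and, mem_biUnion, mem_sdiff] at hi ⊢
    obtain ⟨x, hx, y, hy, hxy⟩ := hi
    have hA : ¬ ∀ z ∈ S, z i = b := fun h => hxy ((h x hx).trans (h y hy).symm)
    by_cases hb : x i = b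
    · exact ⟨x, hx, hb, hA⟩
    · refine ⟨y, hy, ?_, hA⟩
      cases hX : x i <;> cases hY : y i <;> cases b <;> simp_all
  refine (card_le_card hsub).trans (card_biUnion_le.trans (sum_le_sum fun x hx => ?_))
  refine (card_sdiff_of_subset fun i hi => ?_).le
  simp only [Aset, mem_filter, mem_univ, true_and] at hi ⊢
  exact hi x hx

lemma card_dangerSet_le_min {n s : ℕ} {c : ℝ} (hc : 1 ≤ c) {S T : Finset (Fin n → Bool)}
    (hST : S ⊆ T) (hS : S.Nonempty) (b : Bool) (hmid : ∀ x ∈ S, MiddleLayers n s x)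
    (hgS : (n : ℝ) / 2 - 100 * s * c * S.card ≤ ((Aset S b).card : ℝ))
    (hgT : (n : ℝ) / 2 - 100 * s * c * T.card ≤ ((Aset T (!b)).card : ℝ)) :
    ((dangerSet S).card : ℝ) ≤ 250 * s * c * min ((S.card : ℝ) ^ 2) (T.card : ℝ) := by
  have hs0 : (0 : ℝ) ≤ s := Nat.cast_nonneg s
  have hsc : (s : ℝ) ≤ s * c := le_mul_of_one_le_right hs0 hc
  have hS1 : (1 : ℝ) ≤ S.card := by exact_mod_cast hS.card_pos
  have hSTc : (S.card : ℝ) ≤ T.card := by exact_mod_cast card_le_card hST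
  rw [mul_min_of_nonneg _ _ (by positivity)]
  refine le_min ?_ ?_
  · have hpt : ∀ x ∈ S, (((univ.filter fun i => x i = b).card - (Aset S b).card : ℕ) : ℝ) ≤
        s + 100 * s * c * S.card := by
      intro x hx
      have h1 : (2 : ℝ) * (univ.filter fun i => x i = b).card ≤ n + 2 * s := by
        exact_mod_cast card_filter_eq_le_of_middleLayers (hmid x hx) b
      have hle : (Aset S b).card ≤ (univ.filter fun i => x i = b).card := by
        refine card_le_card fun i hi => ?_
        simp only [Aset, mem_filter, mem_univ, true_and] at hi ⊢
        exact hi x hx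
      rw [Nat.cast_sub hle]
      linarith
    have hsum : ((dangerSet S).card : ℝ) ≤ S.card * (s + 100 * s * c * S.card) := by
      refine (Nat.cast_le.mpr (card_dangerSet_le_sum S b)).trans ?_
      rw [Nat.cast_sum, ← nsmul_eq_mul]
      exact sum_le_card_nsmul _ _ _ hpt
    have h2 : (S.card : ℝ) * s ≤ s * c * (S.card : ℝ) ^ 2 := by
      have h3 : (S.card : ℝ) ≤ (S.card : ℝ) ^ 2 := by nlinarith
      calc (S.card : ℝ) * s ≤ (S.card : ℝ) ^ 2 * (s * c) := by gcongr
        _ = _ := by ring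
    have h4 : 0 ≤ s * c * (S.card : ℝ) ^ 2 := by positivity
    linarith
  · have h : ((dangerSet S).card : ℝ) + (Aset S b).card + (Aset T (!b)).card ≤ n := by
      exact_mod_cast card_dangerSet_add_le hST hS b
    have h2 : s * c * (S.card : ℝ) ≤ s * c * T.card := by gcongr
    have h3 : 0 ≤ s * c * (T.card : ℝ) := by positivity
    linarith

lemma subset_of_append {n ℓ : ℕ} {α : Type*} {P : List α → Finset (Fin n → Bool)}
    (hnest : ∀ u : List α, 1 ≤ u.length → u.length ≤ 2 * ℓ - 1 → ∀ a : α, P (a :: u) ⊆ P u)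
    {v : List α} (hv : 1 ≤ v.length) :
    ∀ w : List α, w.length + v.length ≤ 2 * ℓ → P (w ++ v) ⊆ P v
  | [], _ => subset_rfl
  | a :: w, hw => by
    simp only [List.length_cons] at hw
    refine (hnest (w ++ v) ?_ ?_ a).trans (subset_of_append hnest hv w (by omega)) <;>
      simp only [List.length_append] <;> omega

lemma Bset_subset_biUnion {n N ℓ : ℕ} {P : List (Fin N) → Finset (Fin n → Bool)}
    (hnest : ∀ u : List (Fin N), 1 ≤ u.length → u.length ≤ 2 * ℓ - 1 →
      ∀ a : Fin N, P (a :: u) ⊆ P u)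
    {u : List (Fin N)} (hu : u.length < 2 * ℓ) :
    Bset ℓ P u ⊆ univ.biUnion fun a => dangerSet (P (a :: u)) := by
  intro i hi
  simp only [Bset, dangerSet, mem_filter, mem_univ, true_and, mem_biUnion] at hi ⊢
  obtain ⟨w, hw, x, hx, y, hy, hxy⟩ := hi
  rcases List.eq_nil_or_concat w with rfl | ⟨w', a, rfl⟩
  · simp at hw
    omega
  · simp only [List.concat_eq_append, List.append_assoc, List.cons_append, List.nil_append, List.length_append,
      List.length_cons, List.length_nil] at hw hx hy
    have hsub := subset_of_append hnest (v := a :: u) (by simp) w'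
      (by simp only [List.length_cons]; omega)
    exact ⟨a, x, hsub hx, y, hsub hy, hxy⟩

/-- with nesting (i) and goodness (iii), every node `u` at level
`1 ≤ k ≤ 2ℓ-1` satisfies `|B_u| ≤ 250 √n (log₂ n) ∑_a min(|P_{u∘a}|², |P_u|)`. -/
theorem stmt8 (ℓ n s : ℕ) (hℓ : 1 ≤ ℓ) (hn : 2 ≤ n) (hs : s * s = n)
    (N : ℕ) (hN : N = 2 ^ s)
    (P : List (Fin N) → Finset (Fin n → Bool))
    (hmid : ∀ u : List (Fin N), 1 ≤ u.length → u.length ≤ 2 * ℓ →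
      ∀ x ∈ P u, MiddleLayers n s x)
    (hnest : ∀ u : List (Fin N), 1 ≤ u.length → u.length ≤ 2 * ℓ - 1 →
      ∀ a : Fin N, P (a :: u) ⊆ P u)
    (hgood1 : ∀ u : List (Fin N), u.length % 2 = 1 → u.length ≤ 2 * ℓ →
      (P u).Nonempty →
      (n : ℝ) / 2 - 100 * s * Real.logb 2 n * (P u).card ≤ ((Aset (P u) true).card : ℝ))
    (hgood0 : ∀ u : List (Fin N), u.length % 2 = 0 → 1 ≤ u.length → u.length ≤ 2 * ℓ →
      (P u).Nonempty →
      (n : ℝ) / 2 - 100 * s * Real.logb 2 n * (P u).card ≤ ((Aset (P u) false).card : ℝ)) :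
    ∀ u : List (Fin N), 1 ≤ u.length → u.length ≤ 2 * ℓ - 1 →
      ((Bset ℓ P u).card : ℝ) ≤ 250 * s * Real.logb 2 n *
        ∑ a : Fin N, min (((P (a :: u)).card : ℝ) ^ 2) ((P u).card : ℝ) := by
  intro u hu1 hu2
  have hc : 1 ≤ Real.logb 2 n := by
    rw [Real.le_logb_iff_rpow_le (by norm_num) (by positivity)]
    simpa using hn
  have hB := (card_le_card (Bset_subset_biUnion hnest (u := u) (by omega))).trans card_biUnion_le
  refine (Nat.cast_le.mpr hB).trans ?_
  rw [Nat.cast_sum, mul_sum]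
  refine sum_le_sum fun a _ => ?_
  rcases (P (a :: u)).eq_empty_or_nonempty with hE | hne
  · simp [hE, dangerSet]
  have hsub := hnest u hu1 hu2 a
  have hlen : (a :: u).length = u.length + 1 := rfl
  have hmid' := hmid (a :: u) (by omega) (by omega)
  rcases Nat.mod_two_eq_zero_or_one u.length with h | h
  · exact card_dangerSet_le_min hc hsub hne true hmid'
      (hgood1 _ (by omega) (by omega) hne) (hgood0 _ h hu1 (by omega) (hne.mono hsub))
  · exact card_dangerSet_le_min hc hsub hne false hmid'
      (hgood0 _ (by omega) (by omega) (by omega) hne) (hgood1 _ h (by omega) (hne.mono hsub))
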